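/- arXiv:math/0204060 — 2 statements merged into one kernel-verified Lean document; each statement's English description precedes it below -/
import Mathlib

section
/- Suppose λ₁,…,λ_N : I → ℝ are C¹ functions on an interval I, and μ₁,…,μ_k (k ≤ N) are C¹ functions on I such that for all t ∈ I and z ∈ ℝ, the cardinality of {j ≤ k : μⱼ(t) = z} is at most the cardinality of {i : λᵢ(t) = z}. Then there exist C¹ functions μ_{k+1},…,μ_N on I such that for all t ∈ I and z ∈ ℝ, |{j ≤ N : μⱼ(t) = z}| = |{i : λᵢ(t) = z}|. -/
open Set Filter Topology

/-- Two permutations whose labels agree on `p`: correct the second off `p` so that all labels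
agree. -/
lemma perm_correct {ι Q : Type*} [Fintype ι] (p : ι → Prop) (c : ι → Q)
    (τ τ' : Equiv.Perm ι) (h : ∀ j, p j → c (τ' j) = c (τ j)) :
    ∃ τ'' : Equiv.Perm ι, (∀ j, p j → τ'' j = τ' j) ∧ ∀ j, c (τ'' j) = c (τ j) := by
  classical
  have hcard : ∀ q : Q, Nonempty ({a : {j // ¬ p j} // c (τ a) = q} ≃
      {a : {j // ¬ p j} // c (τ' a) = q}) := by
    intro q
    have key : ∀ σ : Equiv.Perm ι, Fintype.card {a : {j // ¬ p j} // c (σ a) = q} +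
        (Finset.univ.filter (fun j => p j ∧ c (σ j) = q)).card
        = (Finset.univ.filter (fun i => c i = q)).card := by
      intro σ
      have h1 : Fintype.card {a : {j // ¬ p j} // c (σ a) = q}
          = (Finset.univ.filter (fun j => ¬ p j ∧ c (σ j) = q)).card := by
        rw [← Fintype.card_subtype]
        exact Fintype.card_congr (Equiv.subtypeSubtypeEquivSubtypeInter _ (fun j => c (σ j) = q))
      have h2 : (Finset.univ.filter (fun i => c i = q)).card
          = (Finset.univ.filter (fun j => c (σ j) = q)).card := by
        rw [← Fintype.card_subtype, ← Fintype.card_subtype]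
        exact (Fintype.card_congr (σ.subtypeEquiv (fun a => Iff.rfl))).symm
      rw [h1, h2, ← Finset.card_filter_add_card_filter_not (s := Finset.univ.filter (fun j => c (σ j) = q)) p,
        Finset.filter_filter, Finset.filter_filter, add_comm]
      simp only [and_comm]
    have h3 : (Finset.univ.filter (fun j => p j ∧ c (τ j) = q))
        = (Finset.univ.filter (fun j => p j ∧ c (τ' j) = q)) := by
      ext j
      simp only [Finset.mem_filter, Finset.mem_univ, true_and]
      constructor
      · rintro ⟨a, b⟩; exact ⟨a, by rw [h j a, b]⟩
      · rintro ⟨a, b⟩; exact ⟨a, by rw [← h j a, b]⟩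
    have h4 := key τ
    have h5 := key τ'
    rw [h3] at h4
    exact ⟨Fintype.equivOfCardEq (by omega)⟩
  let e : Equiv.Perm {j // ¬ p j} := Equiv.ofFiberEquiv
    (f := fun a : {j // ¬ p j} => c (τ a)) (g := fun a : {j // ¬ p j} => c (τ' a))
    (fun q => (hcard q).some)
  have he : ∀ a, c (τ' (e a)) = c (τ a) := fun a =>
    Equiv.ofFiberEquiv_map (f := fun a : {j // ¬ p j} => c (τ a))
      (g := fun a : {j // ¬ p j} => c (τ' a)) (fun q => (hcard q).some) a
  have hfix : ∀ j, p j → Equiv.Perm.ofSubtype e j = j := fun j hj =>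
    Equiv.Perm.ofSubtype_apply_of_not_mem e (not_not.2 hj)
  refine ⟨(Equiv.Perm.ofSubtype e).trans τ', fun j hj => ?_, fun j => ?_⟩
  · simp [hfix j hj]
  · by_cases hj : p j
    · simp [hfix j hj, h j hj]
    · simp only [Equiv.trans_apply]
      rw [Equiv.Perm.ofSubtype_apply_of_mem e hj]
      exact he ⟨j, hj⟩

/-- The abstract selection lemma. -/
lemma select_core {T ι Y : Type*} [LinearOrder T] [Fintype ι] (p : ι → Prop)
    (X : ι → T → Y) (y : ι → T → Y) (U : T → Set T) (hU : ∀ t, (U t).OrdConnected)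
    (hself : ∀ t, t ∈ U t)
    (hex : ∀ t, ∃ τ : Equiv.Perm ι, ∀ j, p j → X (τ j) t = y j t)
    (hloc : ∀ t₀, ∀ t ∈ U t₀, ∀ τ : Equiv.Perm ι,
      (∀ j, p j → X (τ j) t = y j t) → ∀ j, p j → X (τ j) t₀ = y j t₀) :
    ∃ τ : T → Equiv.Perm ι, (∀ t, ∀ j, p j → X (τ t j) t = y j t) ∧
      ∀ t₀, ∀ t ∈ U t₀, ∀ j, X (τ t j) t₀ = X (τ t₀ j) t₀ := by
  classical
  have hfin : ∀ P : Finset T, ∃ τ : T → Equiv.Perm ι,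
      (∀ t ∈ P, ∀ j, p j → X (τ t j) t = y j t) ∧
      ∀ t₀, ∀ s ∈ P, ∀ t ∈ P, s ∈ U t₀ → t ∈ U t₀ → ∀ j, X (τ s j) t₀ = X (τ t j) t₀ := by
    intro P
    induction P using Finset.induction_on_max with
    | empty => exact ⟨fun _ => Equiv.refl _, by simp, by simp⟩
    | insert a P ha ih =>
      obtain ⟨τ, h1, h2⟩ := ih
      obtain ⟨σ, hσ⟩ := hex a
      have haP : a ∉ P := fun h => lt_irrefl _ (ha a h)
      rcases P.eq_empty_or_nonempty with rfl | hne
      · refine ⟨fun _ => σ, ?_, ?_⟩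
        · intro t ht j hj
          have : t = a := by simpa using ht
          subst this
          exact hσ j hj
        · intros; rfl
      · set m := P.max' hne with hm
        have hmP : m ∈ P := P.max'_mem hne
        obtain ⟨ρ, hρ1, hρ2⟩ := perm_correct p
          (fun i => fun t₀ : {t₀ : T // m ∈ U t₀ ∧ a ∈ U t₀} => X i t₀) (τ m) σ (by
            intro j hj
            funext t₀
            obtain ⟨t₀, hmt, hat⟩ := t₀
            exact (hloc t₀ a hat σ hσ j hj).trans (hloc t₀ m hmt (τ m) (h1 m hmP) j hj).symm)
        have key : ∀ t₀, ∀ s ∈ P, s ∈ U t₀ → a ∈ U t₀ → ∀ j, X (τ s j) t₀ = X (ρ j) t₀ := by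
          intro t₀ s hs hsU haU j
          have hmU : m ∈ U t₀ := (hU t₀).out hsU haU ⟨P.le_max' s hs, (ha m hmP).le⟩
          rw [h2 t₀ s hs m hmP hsU hmU j]
          exact (congrFun (hρ2 j) ⟨t₀, hmU, haU⟩).symm
        have hne' : ∀ s ∈ P, s ≠ a := fun s hs h => haP (h ▸ hs)
        refine ⟨Function.update τ a ρ, ?_, ?_⟩
        · intro t ht j hj
          rcases Finset.mem_insert.1 ht with rfl | ht
          · rw [Function.update_self, hρ1 j hj, hσ j hj]
          · rw [Function.update_of_ne (hne' t ht)]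
            exact h1 t ht j hj
        · intro t₀ s hs t ht hsU htU j
          rcases Finset.mem_insert.1 hs with hsa | hsP <;>
            rcases Finset.mem_insert.1 ht with hta | htP
          · rw [hsa, hta]
          · subst hsa
            rw [Function.update_self, Function.update_of_ne (hne' t htP), key t₀ t htP htU hsU]
          · subst hta
            rw [Function.update_self, Function.update_of_ne (hne' s hsP), key t₀ s hsP hsU htU]
          · rw [Function.update_of_ne (hne' t htP), Function.update_of_ne (hne' s hsP)]
            exact h2 t₀ s hsP t htP hsU htU j
  choose g hg1 hg2 using hfin
  obtain ⟨χ, hχ⟩ := Finset.rado_selection (β := fun _ : T => Equiv.Perm ι) g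
  refine ⟨χ, fun t j hj => ?_, fun t₀ t ht j => ?_⟩
  · obtain ⟨P, hP, hP2⟩ := hχ {t}
    rw [hP2 t (by simp)]
    exact hg1 P t (hP (by simp)) j hj
  · obtain ⟨P, hP, hP2⟩ := hχ {t, t₀}
    rw [hP2 t (by simp), hP2 t₀ (by simp)]
    exact hg2 P t₀ t (hP (by simp)) t₀ (hP (by simp)) ht (hself t₀) j

/-- A counting inequality gives a matching permutation. -/
lemma exists_perm_of_count (N k : ℕ) (hk : k ≤ N) (a : Fin N → ℝ) (b : Fin k → ℝ)
    (h : ∀ z, {j : Fin k | b j = z}.ncard ≤ {i : Fin N | a i = z}.ncard) :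
    ∃ τ : Equiv.Perm (Fin N), ∀ (j : Fin N) (hj : (j : ℕ) < k), a (τ j) = b ⟨j, hj⟩ := by
  classical
  have he : ∀ z, Nonempty ({j : Fin k // b j = z} ↪ {i : Fin N // a i = z}) := by
    intro z
    apply Function.Embedding.nonempty_of_card_le
    have := h z
    rw [← Nat.card_coe_set_eq, ← Nat.card_coe_set_eq] at this
    rw [← Nat.card_eq_fintype_card, ← Nat.card_eq_fintype_card]
    exact this
  let e := fun z => (he z).some
  let σ : Fin k → Fin N := fun j => (e (b j) ⟨j, rfl⟩).1
  have hσ : ∀ j, a (σ j) = b j := fun j => (e (b j) ⟨j, rfl⟩).2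
  have hσ' : ∀ j z (hz : b j = z), σ j = (e z ⟨j, hz⟩).1 := by
    rintro j z rfl; rfl
  have hinj : Function.Injective σ := by
    intro j j' hjj
    have hb : b j = b j' := by rw [← hσ j, ← hσ j', hjj]
    rw [hσ' j _ hb, hσ' j' _ rfl] at hjj
    have := (e (b j')).injective (Subtype.ext hjj)
    exact congrArg Subtype.val this
  let σ' : {j : Fin N // (j : ℕ) < k} → Fin N := fun j => σ ⟨j.1, j.2⟩
  have hinj' : Function.Injective σ' := by
    intro x x' hx
    have := hinj hx
    simp only [Fin.mk.injEq] at this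
    exact Subtype.ext (Fin.ext this)
  let E : {j : Fin N // (j : ℕ) < k} ≃ {i : Fin N // i ∈ Set.range σ'} :=
    Equiv.ofInjective σ' hinj'
  refine ⟨E.extendSubtype, fun j hj => ?_⟩
  rw [Equiv.extendSubtype_apply_of_mem E j hj]
  exact hσ ⟨j, hj⟩

/-- Completion lemma (C¹ case): a partial C¹ parameterization `μ₁,…,μ_k` of the values
of C¹ functions `λ₁,…,λ_N` (with multiplicities) can be completed to a full one. -/
theorem extend_C1_parameterization
    (I : Set ℝ) (hI : I.OrdConnected)
    (N k : ℕ) (hk : k ≤ N)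
    (lam : Fin N → ℝ → ℝ) (hlam : ∀ i, ContDiffOn ℝ 1 (lam i) I)
    (μ : Fin k → ℝ → ℝ) (hμ : ∀ j, ContDiffOn ℝ 1 (μ j) I)
    (hle : ∀ t ∈ I, ∀ z : ℝ,
      {j : Fin k | μ j t = z}.ncard ≤ {i : Fin N | lam i t = z}.ncard) :
    ∃ ν : Fin N → ℝ → ℝ,
      (∀ j, ContDiffOn ℝ 1 (ν j) I) ∧
      (∀ j : Fin N, (h : (j : ℕ) < k) → ν j = μ ⟨j, h⟩) ∧
      (∀ t ∈ I, ∀ z : ℝ,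
        {j : Fin N | ν j t = z}.ncard = {i : Fin N | lam i t = z}.ncard) := by
  classical
  have hval : ∀ t ∈ I, ∃ τ : Equiv.Perm (Fin N),
      ∀ (j : Fin N) (hj : (j : ℕ) < k), lam (τ j) t = μ ⟨j, hj⟩ t := fun t ht =>
    exists_perm_of_count N k hk (fun i => lam i t) (fun j => μ j t) (hle t ht)
  -- it suffices to find a good family of permutations
  suffices H : ∃ τ : I → Equiv.Perm (Fin N),
      (∀ t : I, ∀ (j : Fin N) (hj : (j : ℕ) < k), lam (τ t j) t = μ ⟨j, hj⟩ t) ∧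
      ∀ j : Fin N, ContDiffOn ℝ 1 (fun t => if h : t ∈ I then lam (τ ⟨t, h⟩ j) t else 0) I by
    obtain ⟨τ, h1, h2⟩ := H
    refine ⟨fun j => if h : (j : ℕ) < k then μ ⟨j, h⟩ else
      fun t => if h : t ∈ I then lam (τ ⟨t, h⟩ j) t else 0, ?_, ?_, ?_⟩
    · intro j
      by_cases h : (j : ℕ) < k
      · simpa only [h, dif_pos] using hμ ⟨j, h⟩
      · simpa only [h, dif_neg, not_false_eq_true] using h2 j
    · intro j h
      simp only [h, dif_pos]
    · intro t ht z
      have hν : ∀ j : Fin N, (if h : (j : ℕ) < k then μ ⟨j, h⟩ else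
          fun t => if h : t ∈ I then lam (τ ⟨t, h⟩ j) t else 0) t = lam (τ ⟨t, ht⟩ j) t := by
        intro j
        by_cases h : (j : ℕ) < k
        · simp only [h, dif_pos]
          exact (h1 ⟨t, ht⟩ j h).symm
        · simp [h, ht]
      simp only [hν]
      rw [← Nat.card_coe_set_eq, ← Nat.card_coe_set_eq]
      exact Nat.card_congr ((τ ⟨t, ht⟩).subtypeEquiv (fun a => Iff.rfl))
  rcases I.subsingleton_or_nontrivial with hs | hnt
  · choose τ hτ using fun t : I => hval t t.2
    refine ⟨τ, hτ, fun j => ?_⟩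
    rcases hs.eq_empty_or_singleton with rfl | ⟨x, rfl⟩
    · exact fun x hx => hx.elim
    · exact (contDiffOn_const (c := lam (τ ⟨x, rfl⟩ j) x)).congr (by
        intro t ht
        obtain rfl : t = x := ht
        simp)
  have hconv : Convex ℝ I := hI.convex
  have huniq : UniqueDiffOn ℝ I :=
    uniqueDiffOn_convex hconv (hconv.nontrivial_iff_nonempty_interior.1 hnt)
  have hld : ∀ i, ∀ t ∈ I, HasDerivWithinAt (lam i) (derivWithin (lam i) I t) I t :=
    fun i t ht => ((hlam i).differentiableOn one_ne_zero t ht).hasDerivWithinAt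
  have hmd : ∀ i, ∀ t ∈ I, HasDerivWithinAt (μ i) (derivWithin (μ i) I t) I t :=
    fun i t ht => ((hμ i).differentiableOn one_ne_zero t ht).hasDerivWithinAt
  have hlc : ∀ i, ContinuousOn (derivWithin (lam i) I) I := fun i =>
    ((contDiffOn_one_iff_derivWithin huniq).1 (hlam i)).2
  let X : Fin N → I → ℝ × ℝ := fun i t => (lam i t, derivWithin (lam i) I t)
  let y : Fin N → I → ℝ × ℝ := fun j t =>
    if h : (j : ℕ) < k then (μ ⟨j, h⟩ t, derivWithin (μ ⟨j, h⟩) I t) else 0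
  have hy : ∀ (j : Fin N) (h : (j : ℕ) < k) t,
      y j t = (μ ⟨j, h⟩ t, derivWithin (μ ⟨j, h⟩) I t) := fun j h t => by simp only [y, h, dif_pos]
  have hev : ∀ t₀ : I, ∀ᶠ t in 𝓝[I \ {(t₀ : ℝ)}] (t₀ : ℝ), ∀ i : Fin N, ∀ j : Fin k,
      lam i t = μ j t → lam i t₀ = μ j t₀ ∧ derivWithin (lam i) I t₀ = derivWithin (μ j) I t₀ := by
    intro t₀
    refine eventually_all.2 fun i => eventually_all.2 fun j => ?_
    have hd := (hld i t₀ t₀.2).sub (hmd j t₀ t₀.2)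
    by_cases h1 : lam i t₀ = μ j t₀
    · by_cases h2 : derivWithin (lam i) I t₀ = derivWithin (μ j) I t₀
      · exact Eventually.of_forall fun t _ => ⟨h1, h2⟩
      · filter_upwards [hd.eventually_ne (c := 0) (sub_ne_zero.2 h2)] with t ht h
        exact (ht (by simp [h])).elim
    · have hc := hd.continuousWithinAt.mono (sdiff_subset (t := {(t₀ : ℝ)}))
      have := hc.eventually (isOpen_ne.mem_nhds (sub_ne_zero.2 h1))
      filter_upwards [this] with t ht h
      exact (ht (by simp [h])).elim
  have hball : ∀ t₀ : I, ∃ ε > 0, ∀ t ∈ I, |t - t₀| < ε → t ≠ t₀ → ∀ i : Fin N, ∀ j : Fin k,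
      lam i t = μ j t → lam i t₀ = μ j t₀ ∧
        derivWithin (lam i) I t₀ = derivWithin (μ j) I t₀ := by
    intro t₀
    obtain ⟨ε, hε, h⟩ := Metric.mem_nhdsWithin_iff.1 (hev t₀)
    exact ⟨ε, hε, fun t ht h1 h2 => h ⟨by simpa [Real.dist_eq] using h1, ht, h2⟩⟩
  choose ε hε hεU using hball
  obtain ⟨τ, hτ1, hτ2⟩ := select_core (fun j : Fin N => (j : ℕ) < k) X y
    (fun t₀ => {t : I | |(t : ℝ) - t₀| < ε t₀})
    (by
      intro t₀
      refine ⟨fun a ha b hb c hc => ?_⟩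
      simp only [mem_ofPred_eq, abs_lt] at ha hb ⊢
      have h1 : (a : ℝ) ≤ c := hc.1
      have h2 : (c : ℝ) ≤ b := hc.2
      constructor <;> linarith)
    (fun t₀ => by simpa using hε t₀)
    (by
      intro t₀
      have hne : (𝓝[I \ {(t₀ : ℝ)}] (t₀ : ℝ)).NeBot := by
        have := (huniq t₀ t₀.2).accPt
        exact accPt_principal_iff_nhdsWithin.1 this
      obtain ⟨t, ht, htI⟩ := ((hev t₀).and self_mem_nhdsWithin).exists
      obtain ⟨τ, hτ⟩ := hval t htI.1
      refine ⟨τ, fun j hj => ?_⟩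
      rw [hy j hj]
      exact Prod.ext_iff.2 (ht (τ j) ⟨j, hj⟩ (hτ j hj)))
    (by
      intro t₀ t ht τ hτ j hj
      by_cases hte : t = t₀
      · subst hte; exact hτ j hj
      · have h := hτ j hj
        rw [hy j hj] at h ⊢
        exact Prod.ext_iff.2 (hεU t₀ t t.2 ht (fun h => hte (Subtype.ext h)) (τ j) ⟨j, hj⟩
          (Prod.ext_iff.1 h).1))
  refine ⟨τ, fun t j hj => ?_, fun j => ?_⟩
  · have := hτ1 t j hj
    rw [hy j hj] at this
    exact (Prod.ext_iff.1 this).1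
  have hnear : ∀ t₀ : I, ∀ᶠ t in 𝓝[I] (t₀ : ℝ), ∃ ht : t ∈ I,
      lam (τ ⟨t, ht⟩ j) t₀ = lam (τ t₀ j) t₀ ∧
      derivWithin (lam (τ ⟨t, ht⟩ j)) I t₀ = derivWithin (lam (τ t₀ j)) I t₀ := by
    intro t₀
    filter_upwards [self_mem_nhdsWithin,
      mem_nhdsWithin_of_mem_nhds (Metric.ball_mem_nhds (t₀ : ℝ) (hε t₀))] with t ht htb
    refine ⟨ht, ?_⟩
    exact Prod.ext_iff.1 (hτ2 t₀ ⟨t, ht⟩ (by simpa [Real.dist_eq] using htb) j)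
  have hder : ∀ t₀ : I, HasDerivWithinAt
      (fun t => if h : t ∈ I then lam (τ ⟨t, h⟩ j) t else 0)
      (derivWithin (lam (τ t₀ j)) I t₀) I t₀ := by
    intro t₀
    rw [hasDerivWithinAt_iff_isLittleO, Asymptotics.isLittleO_iff]
    intro c hc
    have hall : ∀ᶠ t in 𝓝[I] (t₀ : ℝ), ∀ i, ‖lam i t - lam i t₀ -
        (t - t₀) • derivWithin (lam i) I t₀‖ ≤ c * ‖t - t₀‖ := by
      refine eventually_all.2 fun i => ?_
      have := hasDerivWithinAt_iff_isLittleO.1 (hld i t₀ t₀.2)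
      exact Asymptotics.isLittleO_iff.1 this hc
    filter_upwards [hall, hnear t₀] with t h1 ⟨ht, h2, h3⟩
    have := h1 (τ ⟨t, ht⟩ j)
    rw [h2, h3] at this
    simpa [ht] using this
  rw [contDiffOn_one_iff_derivWithin huniq]
  refine ⟨fun t ht => (hder ⟨t, ht⟩).differentiableWithinAt, ?_⟩
  have heq : ∀ t : I, derivWithin (fun t => if h : t ∈ I then lam (τ ⟨t, h⟩ j) t else 0) I t
      = derivWithin (lam (τ t j)) I t := fun t => (hder t).derivWithin (huniq t t.2)
  intro t₀ ht₀
  rw [ContinuousWithinAt, heq ⟨t₀, ht₀⟩, Metric.tendsto_nhds]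
  intro c hc
  have hall : ∀ᶠ t in 𝓝[I] t₀, ∀ i, dist (derivWithin (lam i) I t) (derivWithin (lam i) I t₀) < c :=
    eventually_all.2 fun i => Metric.tendsto_nhds.1 (hlc i t₀ ht₀) c hc
  filter_upwards [hall, hnear ⟨t₀, ht₀⟩] with t h1 ⟨ht, h2, h3⟩
  have := h1 (τ ⟨t, ht⟩ j)
  rw [h3] at this
  rw [heq ⟨t, ht⟩]
  exact this
end

section
/- Suppose λ₁,…,λ_N : I → ℝ are twice differentiable functions on an interval I, and μ₁,…,μ_k (k ≤ N) are twice differentiable functions on I such that for all t ∈ I and z ∈ ℝ, |{j ≤ k : μⱼ(t) = z}| ≤ |{i : λᵢ(t) = z}|. Then there exist twice differentiable functions μ_{k+1},…,μ_N on I such that for all t ∈ I and z ∈ ℝ, |{j ≤ N : μⱼ(t) = z}| = |{i : λᵢ(t) = z}|. -/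
/-- `f` is twice differentiable on `I`: the derivative exists on `I` and is again
differentiable on `I` (the second derivative need not be continuous). -/
def TwiceDiffOn (f : ℝ → ℝ) (I : Set ℝ) : Prop :=
  ∃ f' : ℝ → ℝ, (∀ t ∈ I, HasDerivWithinAt f (f' t) I t) ∧
    ∀ t ∈ I, DifferentiableWithinAt ℝ f' I t

open Set Filter Topology

namespace ExtPar

abbrev Jt := ℝ × ℝ × ℝ

def JetAt (F : ℝ → Jt) (S : Set ℝ) (t : ℝ) : Prop :=
  HasDerivWithinAt (fun s => (F s).1) (F t).2.1 S t ∧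
    HasDerivWithinAt (fun s => (F s).2.1) (F t).2.2 S t

theorem JetAt.mono {F : ℝ → Jt} {S T : Set ℝ} {t : ℝ} (h : JetAt F S t) (hT : T ⊆ S) :
    JetAt F T t := ⟨h.1.mono hT, h.2.mono hT⟩

theorem JetAt.congr {F G : ℝ → Jt} {S : Set ℝ} {t : ℝ} (h : JetAt G S t) (ht : t ∈ S)
    (hFG : ∀ s ∈ S, F s = G s) : JetAt F S t := by
  unfold JetAt
  rw [hFG t ht]
  refine ⟨h.1.congr (fun s hs => by simp [hFG s hs]) (by simp [hFG t ht]),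
    h.2.congr (fun s hs => by simp [hFG s hs]) (by simp [hFG t ht])⟩

theorem JetAt.of_nhds {F : ℝ → Jt} {S T : Set ℝ} {t : ℝ} (h : JetAt F T t)
    (hT : T ∈ 𝓝[S] t) : JetAt F S t :=
  ⟨h.1.mono_of_mem_nhdsWithin hT, h.2.mono_of_mem_nhdsWithin hT⟩

theorem JetAt.union {F : ℝ → Jt} {S T : Set ℝ} {t : ℝ} (h : JetAt F S t)
    (h' : JetAt F T t) : JetAt F (S ∪ T) t :=
  ⟨h.1.union h'.1, h.2.union h'.2⟩

theorem JetAt.of_notMem {F : ℝ → Jt} {S : Set ℝ} {t : ℝ} (hS : IsClosed S) (ht : t ∉ S) :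
    JetAt F S t := by
  have : t ∉ closure S := by rwa [hS.closure_eq]
  exact ⟨HasFDerivWithinAt.of_notMem_closure this, HasFDerivWithinAt.of_notMem_closure this⟩

theorem JetAt.eventually_ne {F : ℝ → Jt} {S : Set ℝ} {t : ℝ} (h : JetAt F S t)
    (h0 : F t ≠ 0) : ∀ᶠ s in 𝓝[S] t, F s ≠ 0 := by
  have key : ∀ {p : ℝ → Prop}, (∀ᶠ s in 𝓝[S \ {t}] t, p s) → ∀ᶠ s in 𝓝[S] t, s ≠ t → p s := by
    intro p hp
    rw [eventually_nhdsWithin_iff] at hp ⊢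
    filter_upwards [hp] with s hs h1 h2
    exact hs ⟨h1, h2⟩
  have main : ∀ᶠ s in 𝓝[S] t, s ≠ t → F s ≠ 0 := by
    by_cases h2 : (F t).2.2 = 0
    · by_cases h1 : (F t).2.1 = 0
      · have h3 : (F t).1 ≠ 0 := by
          intro h3
          exact h0 (Prod.ext h3 (Prod.ext h1 h2))
        have := h.1.continuousWithinAt.eventually_ne h3
        filter_upwards [this] with s hs _ h4
        exact hs (by simp [h4])
      · filter_upwards [key (h.1.eventually_ne (c := 0) h1)] with s hs h3 h4
        exact hs h3 (by simp [h4])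
    · filter_upwards [key (h.2.eventually_ne (c := 0) h2)] with s hs h3 h4
      exact hs h3 (by simp [h4])
  filter_upwards [main] with s hs
  by_cases hst : s = t
  · rw [hst]; exact h0
  · exact hs hst

theorem JetAt.of_flat {ι : Type} [Fintype ι] {L : ι → ℝ → Jt} {F : ℝ → Jt} {S : Set ℝ} {t : ℝ}
    (ht : t ∈ S) (hL : ∀ i, JetAt (L i) S t) (h0 : ∀ i, L i t = 0)
    (hF : ∀ s ∈ S, ∃ i, F s = L i s) : JetAt F S t := by
  have hFt : F t = 0 := by
    obtain ⟨i, hi⟩ := hF t ht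
    rw [hi, h0]
  unfold JetAt at *
  simp only [h0] at hL
  rw [hFt]
  have key : ∀ (p : Jt → ℝ), p 0 = 0 → (∀ i, HasDerivWithinAt (fun s => p (L i s)) 0 S t) →
      HasDerivWithinAt (fun s => p (F s)) 0 S t := by
    intro p hp h
    have h' : ∀ i, ((fun s => p (L i s)) =o[𝓝[S] t] fun s => s - t) := by
      intro i
      have := hasDerivWithinAt_iff_isLittleO.1 (h i)
      simpa [h0, hp] using this
    rw [hasDerivWithinAt_iff_isLittleO]
    simp only [hFt, hp, smul_zero, sub_zero]
    rw [Asymptotics.isLittleO_iff]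
    intro c hc
    have h2 : ∀ᶠ s in 𝓝[S] t, ∀ i, ‖p (L i s)‖ ≤ c * ‖s - t‖ :=
      eventually_all.2 fun i => (Asymptotics.isLittleO_iff.1 (h' i)) hc
    filter_upwards [h2, self_mem_nhdsWithin] with s hs hsS
    obtain ⟨i, hi⟩ := hF s hsS
    rw [hi]; exact hs i
  exact ⟨key (fun x => x.1) rfl fun i => (hL i).1, key (fun x => x.2.1) rfl fun i => (hL i).2⟩

structure IsSol {ι : Type} (L : ι → ℝ → Jt) (a : ι) (f : ι → ℝ → Jt) (S : Set ℝ) : Prop where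
  jet : ∀ i, ∀ t ∈ S, JetAt (f i) S t
  zero : ∀ t ∈ S, f a t = 0
  perm : ∀ t ∈ S, ∃ σ : Equiv.Perm ι, ∀ i, f i t = L (σ i) t

theorem IsSol.mono {ι : Type} {L : ι → ℝ → Jt} {a : ι} {f : ι → ℝ → Jt} {S T : Set ℝ}
    (h : IsSol L a f S) (hT : T ⊆ S) : IsSol L a f T :=
  ⟨fun i t ht => (h.jet i t (hT ht)).mono hT, fun t ht => h.zero t (hT ht),
    fun t ht => h.perm t (hT ht)⟩

theorem IsSol.permute {ι : Type} {L : ι → ℝ → Jt} {a : ι} {f : ι → ℝ → Jt} {S : Set ℝ}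
    (h : IsSol L a f S) (π : Equiv.Perm ι) {b : ι} (hb : π b = a) :
    IsSol L b (fun i => f (π i)) S := by
  refine ⟨fun i t ht => h.jet _ t ht, fun t ht => by simp only [hb]; exact h.zero t ht, ?_⟩
  intro t ht
  obtain ⟨σ, hσ⟩ := h.perm t ht
  exact ⟨π.trans σ, fun i => hσ _⟩

theorem glue {ι : Type} {L : ι → ℝ → Jt} {a : ι} {f g : ι → ℝ → Jt} {S T : Set ℝ} {c : ℝ}
    (hf : IsSol L a f S) (hg : IsSol L a g T) (hS : IsClosed S) (hT : IsClosed T)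
    (hST : S ∩ T = {c}) :
    ∃ h, IsSol L a h (S ∪ T) ∧ ∀ t ∈ S, ∀ i, h i t = f i t := by
  classical
  have hc : c ∈ S ∩ T := by rw [hST]; rfl
  obtain ⟨σ, hσ⟩ := hf.perm c hc.1
  obtain ⟨τ, hτ⟩ := hg.perm c hc.2
  obtain ⟨π, hπa, hπ⟩ : ∃ π : Equiv.Perm ι, π a = a ∧ ∀ i, g (π i) c = f i c := by
    let π0 : Equiv.Perm ι := σ.trans τ.symm
    have h0 : ∀ i, g (π0 i) c = f i c := by
      intro i
      rw [hτ, hσ]; simp [π0]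
    refine ⟨π0.trans (Equiv.swap (π0 a) a), by simp, ?_⟩
    intro i
    simp only [Equiv.trans_apply]
    by_cases h1 : π0 i = π0 a
    · rw [h1, Equiv.swap_apply_left, hg.zero c hc.2, ← h0 i, h1, h0 a, hf.zero c hc.1]
    · by_cases h2 : π0 i = a
      · rw [h2, Equiv.swap_apply_right, ← h0 i, h2, h0 a, hf.zero c hc.1, hg.zero c hc.2]
      · rw [Equiv.swap_apply_of_ne_of_ne h1 h2, h0]
  have hg' := hg.permute π hπa
  let h : ι → ℝ → Jt := fun i t => if t ∈ S then f i t else g (π i) t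
  have hhf : ∀ t ∈ S, ∀ i, h i t = f i t := fun t ht i => if_pos ht
  have hhg : ∀ t ∈ T, ∀ i, h i t = g (π i) t := by
    intro t ht i
    by_cases hs : t ∈ S
    · have : t ∈ S ∩ T := ⟨hs, ht⟩
      rw [hST] at this
      obtain rfl : t = c := this
      rw [hhf t hs, hπ]
    · exact if_neg hs
  refine ⟨h, ⟨?_, ?_, ?_⟩, hhf⟩
  · intro i t _
    apply JetAt.union
    · by_cases ht : t ∈ S
      · exact (hf.jet i t ht).congr ht fun s hs => hhf s hs i
      · exact JetAt.of_notMem hS ht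
    · by_cases ht : t ∈ T
      · exact (hg'.jet i t ht).congr ht fun s hs => hhg s hs i
      · exact JetAt.of_notMem hT ht
  · rintro t (ht | ht)
    · rw [hhf t ht, hf.zero t ht]
    · rw [hhg t ht]; exact hg'.zero t ht
  · rintro t (ht | ht)
    · simp only [hhf t ht]; exact hf.perm t ht
    · simp only [hhg t ht]; exact hg'.perm t ht

theorem sol_Icc {ι : Type} {L : ι → ℝ → Jt} {a : ι} {x y : ℝ} (hxy : x ≤ y)
    (hloc : ∀ t ∈ Icc x y, ∃ U : Set ℝ, IsOpen U ∧ t ∈ U ∧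
      ∀ T ⊆ U ∩ Icc x y, T.OrdConnected → ∃ f, IsSol L a f T) :
    ∃ f, IsSol L a f (Icc x y) := by
  choose! U hU htU hsol using hloc
  obtain ⟨t, ht0, hmono, ⟨m, hm⟩, hcov⟩ :=
    exists_monotone_Icc_subset_open_cover_Icc hxy
      (c := fun i : Icc x y => (Subtype.val ⁻¹' U i : Set (Icc x y)))
      (fun i => (hU i i.2).preimage continuous_subtype_val)
      (fun z _ => mem_iUnion.2 ⟨z, htU z z.2⟩)
  have piece : ∀ n, ∃ f, IsSol L a f (Icc (t n : ℝ) (t (n + 1))) := by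
    intro n
    obtain ⟨i, hi⟩ := hcov n
    refine hsol i i.2 _ ?_ ordConnected_Icc
    intro s hs
    have hs' : s ∈ Icc x y := ⟨(t n).2.1.trans hs.1, hs.2.trans (t (n + 1)).2.2⟩
    exact ⟨hi (a := ⟨s, hs'⟩) ⟨hs.1, hs.2⟩, hs'⟩
  have all : ∀ n, ∃ f, IsSol L a f (Icc x (t n : ℝ)) := by
    intro n
    induction n with
    | zero =>
      obtain ⟨f, hf⟩ := piece 0
      refine ⟨f, hf.mono ?_⟩
      intro s hs
      exact ⟨ht0.le.trans hs.1, hs.2.trans (hmono (Nat.zero_le 1))⟩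
    | succ n ih =>
      obtain ⟨f, hf⟩ := ih
      obtain ⟨g, hg⟩ := piece n
      have h1 : x ≤ t n := (t n).2.1
      have h2 : (t n : ℝ) ≤ t (n + 1) := hmono (Nat.le_succ n)
      obtain ⟨h, hh, -⟩ := glue (c := t n) hf hg isClosed_Icc isClosed_Icc
        (by rw [Icc_inter_Icc_eq_singleton h1 h2])
      rw [Icc_union_Icc_eq_Icc h1 h2] at hh
      exact ⟨h, hh⟩
  have := all m
  rwa [hm m le_rfl] at this

theorem sol_ext {ι : Type} {L : ι → ℝ → Jt} {a : ι} {x y x' y' : ℝ} {f : ι → ℝ → Jt}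
    (hf : IsSol L a f (Icc x y)) (hx : x' ≤ x) (hxy : x ≤ y) (hy : y ≤ y')
    (h1 : ∃ g, IsSol L a g (Icc x' x)) (h2 : ∃ g, IsSol L a g (Icc y y')) :
    ∃ g, IsSol L a g (Icc x' y') ∧ ∀ t ∈ Icc x y, ∀ i, g i t = f i t := by
  obtain ⟨g1, hg1⟩ := h1
  obtain ⟨g2, hg2⟩ := h2
  obtain ⟨h, hh, hhf⟩ := glue (c := y) hf hg2 isClosed_Icc isClosed_Icc
        (by rw [Icc_inter_Icc_eq_singleton hxy hy])
  rw [Icc_union_Icc_eq_Icc hxy hy] at hh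
  obtain ⟨k, hk, hkh⟩ := glue (c := x) hh hg1 isClosed_Icc isClosed_Icc
        (by rw [inter_comm, Icc_inter_Icc_eq_singleton hx (hxy.trans hy)])
  rw [union_comm, Icc_union_Icc_eq_Icc hx (hxy.trans hy)] at hk
  exact ⟨k, hk, fun t ht i => by rw [hkh t ⟨ht.1, ht.2.trans hy⟩, hhf t ht]⟩

theorem sol_global {ι : Type} {L : ι → ℝ → Jt} {a : ι} {C : Set ℝ} (hC : C.OrdConnected)
    (hcpt : ∀ x ∈ C, ∀ y ∈ C, x ≤ y → ∃ f, IsSol L a f (Icc x y)) :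
    ∃ f, IsSol L a f C := by
  classical
  rcases C.eq_empty_or_nonempty with rfl | ⟨p, hp⟩
  · exact ⟨fun _ _ => 0, ⟨by simp, by simp, by simp⟩⟩
  have : Nonempty C := ⟨⟨p, hp⟩⟩
  obtain ⟨u, humono, hu⟩ := exists_seq_monotone_tendsto_atTop_atTop C
  obtain ⟨v, hvanti, hv⟩ := exists_seq_antitone_tendsto_atTop_atBot C
  let y : ℕ → ℝ := fun n => max p (u n)
  let x : ℕ → ℝ := fun n => min p (v n)
  have hyC : ∀ n, y n ∈ C := by
    intro n
    rcases max_choice p (u n : ℝ) with h | h <;> simp only [y, h]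
    · exact hp
    · exact (u n).2
  have hxC : ∀ n, x n ∈ C := by
    intro n
    rcases min_choice p (v n : ℝ) with h | h <;> simp only [x, h]
    · exact hp
    · exact (v n).2
  have hxy : ∀ n, x n ≤ y n := fun n => (min_le_left _ _).trans (le_max_left _ _)
  have hymono : Monotone y := fun m n hmn => max_le_max le_rfl (humono hmn)
  have hxanti : Antitone x := fun m n hmn => min_le_min le_rfl (hvanti hmn)
  have hycof : ∀ z ∈ C, ∃ n, z ≤ y n := by
    intro z hz
    obtain ⟨n, hn⟩ := (hu.eventually_ge_atTop ⟨z, hz⟩).exists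
    exact ⟨n, le_trans (show z ≤ u n from hn) (le_max_right _ _)⟩
  have hxcof : ∀ z ∈ C, ∃ n, x n ≤ z := by
    intro z hz
    obtain ⟨n, hn⟩ := (hv.eventually_le_atBot ⟨z, hz⟩).exists
    exact ⟨n, le_trans (min_le_right _ _) (show (v n : ℝ) ≤ z from hn)⟩
  have hSmono : ∀ m n, m ≤ n → Icc (x m) (y m) ⊆ Icc (x n) (y n) := fun m n hmn =>
    Icc_subset_Icc (hxanti hmn) (hymono hmn)
  have step : ∀ n (f : {f // IsSol L a f (Icc (x n) (y n))}),
      ∃ g : {f // IsSol L a f (Icc (x (n+1)) (y (n+1)))},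
        ∀ t ∈ Icc (x n) (y n), ∀ i, g.1 i t = f.1 i t := by
    intro n f
    have h1 := hxanti (Nat.le_succ n)
    have h2 := hymono (Nat.le_succ n)
    obtain ⟨g, hg, hgf⟩ := sol_ext f.2 h1 (hxy n) h2
      (hcpt _ (hxC _) _ (hxC _) h1) (hcpt _ (hyC _) _ (hyC _) h2)
    exact ⟨⟨g, hg⟩, hgf⟩
  choose nxt hnxt using step
  obtain ⟨f0, hf0⟩ := hcpt _ (hxC 0) _ (hyC 0) (hxy 0)
  let F : ∀ n, {f // IsSol L a f (Icc (x n) (y n))} := fun n => Nat.rec ⟨f0, hf0⟩ nxt n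
  have hF : ∀ n, ∀ t ∈ Icc (x n) (y n), ∀ i, (F (n+1)).1 i t = (F n).1 i t :=
    fun n => hnxt n (F n)
  have hF' : ∀ m n, m ≤ n → ∀ t ∈ Icc (x m) (y m), ∀ i, (F n).1 i t = (F m).1 i t := by
    intro m n hmn t ht i
    induction n, hmn using Nat.le_induction with
    | base => rfl
    | succ n hmn ih => rw [hF n t (hSmono m n hmn ht), ih]
  have hnh : ∀ t ∈ C, ∃ n, t ∈ Icc (x n) (y n) ∧ Icc (x n) (y n) ∈ 𝓝[C] t := by
    intro t ht
    have hA : ∃ n, t ≤ y n ∧ Iic (y n) ∈ 𝓝[C] t := by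
      by_cases h : ∃ z ∈ C, t < z
      · obtain ⟨z, hz, htz⟩ := h
        obtain ⟨n, hn⟩ := hycof z hz
        exact ⟨n, htz.le.trans hn, mem_nhdsWithin_of_mem_nhds (Iic_mem_nhds (htz.trans_le hn))⟩
      · push Not at h
        obtain ⟨n, hn⟩ := hycof t ht
        exact ⟨n, hn, mem_of_superset self_mem_nhdsWithin fun z hz => (h z hz).trans hn⟩
    have hB : ∃ n, x n ≤ t ∧ Ici (x n) ∈ 𝓝[C] t := by
      by_cases h : ∃ z ∈ C, z < t
      · obtain ⟨z, hz, htz⟩ := h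
        obtain ⟨n, hn⟩ := hxcof z hz
        exact ⟨n, hn.trans htz.le, mem_nhdsWithin_of_mem_nhds (Ici_mem_nhds (hn.trans_lt htz))⟩
      · push Not at h
        obtain ⟨n, hn⟩ := hxcof t ht
        exact ⟨n, hn, mem_of_superset self_mem_nhdsWithin fun z hz => hn.trans (h z hz)⟩
    obtain ⟨n, hn, hn'⟩ := hA
    obtain ⟨m, hm, hm'⟩ := hB
    have h1 := hymono (le_max_left n m)
    have h2 := hxanti (le_max_right n m)
    refine ⟨max n m, ⟨h2.trans hm, hn.trans h1⟩, ?_⟩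
    filter_upwards [hn', hm'] with s hs hs'
    exact ⟨h2.trans hs', le_trans hs h1⟩
  choose! K hK hKn using hnh
  let h : ι → ℝ → Jt := fun i t => (F (K t)).1 i t
  have hh : ∀ n, ∀ t ∈ C, t ∈ Icc (x n) (y n) → ∀ i, h i t = (F n).1 i t := by
    intro n t htC ht i
    rcases le_total n (K t) with h' | h'
    · exact hF' _ _ h' t ht i
    · exact (hF' _ _ h' t (hK t htC) i).symm
  have hsub : ∀ n, Icc (x n) (y n) ⊆ C := fun n => hC.out (hxC n) (hyC n)
  refine ⟨h, ⟨?_, ?_, ?_⟩⟩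
  · intro i t ht
    refine JetAt.of_nhds ?_ (hKn t ht)
    exact ((F (K t)).2.jet i t (hK t ht)).congr (hK t ht)
      fun s hs => hh _ s (hsub _ hs) hs i
  · intro t ht
    exact (F (K t)).2.zero t (hK t ht)
  · intro t ht
    exact (F (K t)).2.perm t (hK t ht)

theorem sol_local {ι : Type} {L : ι → ℝ → Jt} {a : ι} {C : Set ℝ} (hC : C.OrdConnected)
    (hloc : ∀ t ∈ C, ∃ U : Set ℝ, IsOpen U ∧ t ∈ U ∧
      ∀ T ⊆ U ∩ C, T.OrdConnected → ∃ f, IsSol L a f T) :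
    ∃ f, IsSol L a f C := by
  refine sol_global hC fun x hx y hy hxy => sol_Icc hxy fun t ht => ?_
  obtain ⟨U, hU, htU, h⟩ := hloc t (hC.out hx hy ht)
  exact ⟨U, hU, htU, fun T hT => h T (hT.trans (inter_subset_inter_right _ (hC.out hx hy)))⟩

theorem exists_sol (n : ℕ) : ∀ (ι : Type) [Fintype ι], Fintype.card ι = n →
    ∀ (L : ι → ℝ → Jt) (a : ι) (S : Set ℝ), S.OrdConnected →
    (∀ i, ∀ t ∈ S, JetAt (L i) S t) → (∀ t ∈ S, ∃ i, L i t = 0) → ∃ f, IsSol L a f S := by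
  classical
  induction n using Nat.strong_induction_on with
  | _ n IH =>
  intro ι _ hcard L a S hS hL h0
  let G : Set ℝ := {t | t ∈ S ∧ ∃ i, L i t ≠ 0}
  have hGS : G ⊆ S := fun t ht => ht.1
  have hGn : ∀ t ∈ G, ∃ V : Set ℝ, IsOpen V ∧ t ∈ V ∧
      ∀ i, L i t ≠ 0 → ∀ s ∈ V ∩ S, L i s ≠ 0 := by
    intro t ht
    have : ∀ᶠ s in 𝓝[S] t, ∀ i, L i t ≠ 0 → L i s ≠ 0 := by
      rw [eventually_all]
      intro i
      by_cases hi : L i t = 0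
      · simp [hi]
      · filter_upwards [(hL i t ht.1).eventually_ne hi] with s hs _ using hs
    obtain ⟨V, hV, htV, hVS⟩ := mem_nhdsWithin.1 this
    exact ⟨V, hV, htV, fun i hi s hs => hVS hs i hi⟩
  have hloc : ∀ t ∈ G, ∃ U : Set ℝ, IsOpen U ∧ t ∈ U ∧
      ∀ T ⊆ U ∩ S, T.OrdConnected → ∃ f, IsSol L a f T := by
    intro t ht
    obtain ⟨V, hV, htV, hVS⟩ := hGn t ht
    refine ⟨V, hV, htV, fun T hT hTo => ?_⟩
    obtain ⟨b, hb⟩ := h0 t ht.1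
    let A := {i : ι // L i t = 0}
    have hcA : Fintype.card A < n := by
      rw [← hcard]
      obtain ⟨i, hi⟩ := ht.2
      exact Fintype.card_subtype_lt hi
    have hTS : T ⊆ S := hT.trans inter_subset_right
    obtain ⟨f, hf⟩ := IH _ hcA A rfl (fun i => L i.1) ⟨b, hb⟩ T hTo
      (fun i s hs => (hL i.1 s (hTS hs)).mono hTS) (by
        intro s hs
        obtain ⟨i, hi⟩ := h0 s (hTS hs)
        by_cases hit : L i t = 0
        · exact ⟨⟨i, hit⟩, hi⟩
        · exact absurd hi (hVS i hit s (hT hs)))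
    let g : ι → ℝ → Jt := fun i => if hi : L i t = 0 then f ⟨i, hi⟩ else L i
    have hg : IsSol L b g T := by
      refine ⟨?_, ?_, ?_⟩
      · intro i s hs
        by_cases hi : L i t = 0
        · simp only [g, hi, dif_pos]; exact hf.jet _ s hs
        · simp only [g, hi, dif_neg, not_false_iff]; exact (hL i s (hTS hs)).mono hTS
      · intro s hs
        simp only [g, hb, dif_pos]; exact hf.zero s hs
      · intro s hs
        obtain ⟨σ, hσ⟩ := hf.perm s hs
        refine ⟨Equiv.Perm.ofSubtype σ, fun i => ?_⟩
        by_cases hi : L i t = 0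
        · rw [Equiv.Perm.ofSubtype_apply_of_mem σ hi]
          simp only [g, hi, dif_pos]; exact hσ _
        · rw [Equiv.Perm.ofSubtype_apply_of_not_mem σ hi]
          simp only [g, hi, dif_neg, not_false_iff]
    exact ⟨_, hg.permute (Equiv.swap a b) (Equiv.swap_apply_left a b)⟩
  have hcomp : ∀ t, ∃ f, IsSol L a f (ordConnectedComponent G t) := by
    intro t
    refine sol_local inferInstance fun s hs => ?_
    obtain ⟨U, hU, hsU, h⟩ := hloc s (ordConnectedComponent_subset hs)
    exact ⟨U, hU, hsU, fun T hT => h T (hT.trans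
      (inter_subset_inter_right _ (ordConnectedComponent_subset.trans hGS)))⟩
  have hex : ∀ C : Set ℝ, ∃ f, (∃ f', IsSol L a f' C) → IsSol L a f C := by
    intro C
    by_cases h : ∃ f', IsSol L a f' C
    · exact ⟨h.choose, fun _ => h.choose_spec⟩
    · exact ⟨fun _ _ => 0, fun h' => absurd h' h⟩
  choose Φ hΦ using hex
  have hΦ' : ∀ t, IsSol L a (Φ (ordConnectedComponent G t)) (ordConnectedComponent G t) :=
    fun t => hΦ _ (hcomp t)
  let h : ι → ℝ → Jt := fun i t => if t ∈ G then Φ (ordConnectedComponent G t) i t else 0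
  have hself : ∀ t ∈ G, t ∈ ordConnectedComponent G t := fun t ht =>
    self_mem_ordConnectedComponent.2 ht
  have hzero : ∀ t ∈ S, t ∉ G → ∀ i, L i t = 0 := by
    intro t ht htG i
    by_contra hne
    exact htG ⟨ht, i, hne⟩
  have hperm : ∀ t ∈ S, ∃ σ : Equiv.Perm ι, ∀ i, h i t = L (σ i) t := by
    intro t ht
    by_cases htG : t ∈ G
    · simp only [h, htG, if_true]
      exact (hΦ' t).perm t (hself t htG)
    · exact ⟨1, fun i => by simp [h, htG, hzero t ht htG]⟩
  refine ⟨h, ⟨?_, ?_, hperm⟩⟩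
  · intro i t ht
    by_cases htG : t ∈ G
    · have hnb : ordConnectedComponent G t ∈ 𝓝[S] t := by
        obtain ⟨V, hV, htV, hVS⟩ := hGn t htG
        obtain ⟨j, hj⟩ := htG.2
        obtain ⟨ε, hε, hball⟩ := Metric.isOpen_iff.1 hV t htV
        filter_upwards [self_mem_nhdsWithin,
          mem_nhdsWithin_of_mem_nhds (Metric.ball_mem_nhds t hε)] with s hsS hs
        rw [mem_ordConnectedComponent]
        intro r hr
        have hrS : r ∈ S := hS.uIcc_subset ht hsS hr
        have hrb : r ∈ Metric.ball t ε := by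
          have : (Metric.ball t ε).OrdConnected := (convex_ball t ε).ordConnected
          exact this.uIcc_subset (Metric.mem_ball_self hε) hs hr
        exact ⟨hrS, j, hVS j hj r ⟨hball hrb, hrS⟩⟩
      refine JetAt.of_nhds ?_ hnb
      refine ((hΦ' t).jet i t (hself t htG)).congr (hself t htG) ?_
      intro s hs
      have hsG : s ∈ G := ordConnectedComponent_subset hs
      simp only [h, hsG, if_true]
      rw [ordConnectedComponent_eq (mem_ordConnectedComponent.1 hs)]
    · refine JetAt.of_flat ht (fun j => hL j t ht) (hzero t ht htG) ?_
      intro s hs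
      obtain ⟨σ, hσ⟩ := hperm s hs
      exact ⟨σ i, hσ i⟩
  · intro t ht
    by_cases htG : t ∈ G
    · simp only [h, htG, if_true]
      exact (hΦ' t).zero t (hself t htG)
    · simp [h, htG]

theorem flat_of_frequently {D D' D'' : ℝ → ℝ} {I : Set ℝ} (hI : I.OrdConnected)
    (h1 : ∀ t ∈ I, HasDerivWithinAt D (D' t) I t)
    (h2 : ∀ t ∈ I, HasDerivWithinAt D' (D'' t) I t) {t : ℝ} (ht : t ∈ I)
    (hfr : ∃ᶠ s in 𝓝[I \ {t}] t, D s = 0) : D t = 0 ∧ D' t = 0 ∧ D'' t = 0 := by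
  have a0 : D t = 0 := by
    by_contra hne
    have := (h1 t ht).continuousWithinAt.eventually_ne hne
    exact hfr (this.filter_mono (nhdsWithin_mono t sdiff_subset))
  have a1 : D' t = 0 := by
    by_contra hne
    exact hfr ((h1 t ht).eventually_ne hne)
  refine ⟨a0, a1, ?_⟩
  by_contra hne
  have hev := (h2 t ht).eventually_ne (c := 0) hne
  obtain ⟨ε, hε, hball⟩ := Metric.mem_nhdsWithin_iff.1 hev
  have hb : ∀ᶠ s in 𝓝[I \ {t}] t, s ∈ Metric.ball t ε ∧ s ∈ I \ {t} :=
    inter_mem (mem_nhdsWithin_of_mem_nhds (Metric.ball_mem_nhds t hε)) self_mem_nhdsWithin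
  obtain ⟨s, hs0, hsb, hsI, hst⟩ := (hfr.and_eventually hb).exists
  have rolle : ∀ x y, x ∈ I → y ∈ I → x < y → D x = 0 → D y = 0 → ∃ r ∈ Ioo x y, D' r = 0 := by
    intro x y hx hy hxy hDx hDy
    have hsub : Icc x y ⊆ I := hI.out hx hy
    refine exists_hasDerivAt_eq_zero (f := D) hxy
      (fun z hz => ((h1 z (hsub hz)).continuousWithinAt).mono hsub) (by rw [hDx, hDy]) ?_
    intro r hr
    exact (h1 r (hsub (Ioo_subset_Icc_self hr))).hasDerivAt
      (mem_of_superset (Icc_mem_nhds hr.1 hr.2) hsub)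
  have hbo : (Metric.ball t ε).OrdConnected := (convex_ball t ε).ordConnected
  have htb := Metric.mem_ball_self (x := t) hε
  rcases lt_or_gt_of_ne (show s ≠ t from hst) with hlt | hlt
  · obtain ⟨r, hr, hr0⟩ := rolle s t hsI ht hlt hs0 a0
    have hr' := Ioo_subset_Icc_self hr
    exact hball ⟨hbo.out hsb htb hr', hI.out hsI ht hr', hr.2.ne⟩ hr0
  · obtain ⟨r, hr, hr0⟩ := rolle t s ht hsI hlt a0 hs0
    have hr' := Ioo_subset_Icc_self hr
    exact hball ⟨hbo.out htb hsb hr', hI.out ht hsI hr', hr.1.ne'⟩ hr0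

theorem exists_jets {ι : Type} [Fintype ι] {I : Set ℝ} (hI : I.OrdConnected)
    (D : ι → ℝ → ℝ) (hD : ∀ i, TwiceDiffOn (D i) I) (h0 : ∀ t ∈ I, ∃ i, D i t = 0) :
    ∃ L : ι → ℝ → Jt, (∀ i t, (L i t).1 = D i t) ∧ (∀ i, ∀ t ∈ I, JetAt (L i) I t) ∧
      ∀ t ∈ I, ∃ i, L i t = 0 := by
  by_cases hsub : I.Subsingleton
  · refine ⟨fun i t => (D i t, 0, 0), fun _ _ => rfl, ?_, ?_⟩
    · intro i t ht
      exact ⟨HasFDerivWithinAt.of_subsingleton hsub, HasFDerivWithinAt.of_subsingleton hsub⟩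
    · intro t ht
      obtain ⟨i, hi⟩ := h0 t ht
      exact ⟨i, by simp [hi]⟩
  · rw [not_subsingleton_iff] at hsub
    choose D' h1 h2 using hD
    have h2' : ∀ i, ∀ t ∈ I, HasDerivWithinAt (D' i) (derivWithin (D' i) I t) I t :=
      fun i t ht => (h2 i t ht).hasDerivWithinAt
    refine ⟨fun i t => (D i t, D' i t, derivWithin (D' i) I t), fun _ _ => rfl,
      fun i t ht => ⟨h1 i t ht, h2' i t ht⟩, ?_⟩
    intro t ht
    have hne : (𝓝[I \ {t}] t).NeBot := by
      have := hI.isPreconnected.preperfect_of_nontrivial hsub t ht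
      rwa [accPt_principal_iff_nhdsWithin] at this
    have : ∃ i, ∃ᶠ s in 𝓝[I \ {t}] t, D i s = 0 := by
      by_contra hcon
      push Not at hcon
      have hall : ∀ᶠ s in 𝓝[I \ {t}] t, ∀ i, ¬ D i s = 0 := eventually_all.2 hcon
      obtain ⟨s, hs, hsI⟩ := (hall.and self_mem_nhdsWithin).exists
      obtain ⟨i, hi⟩ := h0 s hsI.1
      exact hs i hi
    obtain ⟨i, hi⟩ := this
    obtain ⟨e0, e1, e2⟩ := flat_of_frequently hI (h1 i) (h2' i) ht hi
    exact ⟨i, by simp [e0, e1, e2]⟩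

theorem twiceDiffOn_add {f g : ℝ → ℝ} {I : Set ℝ} (hf : TwiceDiffOn f I) (hg : TwiceDiffOn g I) :
    TwiceDiffOn (fun t => f t + g t) I := by
  obtain ⟨f', hf1, hf2⟩ := hf
  obtain ⟨g', hg1, hg2⟩ := hg
  exact ⟨fun t => f' t + g' t, fun t ht => (hf1 t ht).add (hg1 t ht),
    fun t ht => (hf2 t ht).add (hg2 t ht)⟩

theorem twiceDiffOn_sub {f g : ℝ → ℝ} {I : Set ℝ} (hf : TwiceDiffOn f I) (hg : TwiceDiffOn g I) :
    TwiceDiffOn (fun t => f t - g t) I := by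
  obtain ⟨f', hf1, hf2⟩ := hf
  obtain ⟨g', hg1, hg2⟩ := hg
  exact ⟨fun t => f' t - g' t, fun t ht => (hf1 t ht).sub (hg1 t ht),
    fun t ht => (hf2 t ht).sub (hg2 t ht)⟩

theorem extend_one {ι : Type} [Fintype ι] {I : Set ℝ} (hI : I.OrdConnected)
    (lam : ι → ℝ → ℝ) (hlam : ∀ i, TwiceDiffOn (lam i) I) (m : ℝ → ℝ) (hm : TwiceDiffOn m I)
    (h : ∀ t ∈ I, ∃ i, lam i t = m t) (a : ι) :
    ∃ ν : ι → ℝ → ℝ, ν a = m ∧ (∀ i, TwiceDiffOn (ν i) I) ∧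
      ∀ t ∈ I, ∃ σ : Equiv.Perm ι, ∀ i, ν i t = lam (σ i) t := by
  classical
  obtain ⟨L, hL1, hL2, hL3⟩ := exists_jets hI (fun i t => lam i t - m t)
    (fun i => twiceDiffOn_sub (hlam i) hm) (fun t ht => by
      obtain ⟨i, hi⟩ := h t ht
      exact ⟨i, by simp [hi]⟩)
  obtain ⟨f, hf⟩ := exists_sol _ ι rfl L a I hI hL2 hL3
  refine ⟨fun i => if i = a then m else fun t => (f i t).1 + m t, by simp, ?_, ?_⟩
  · intro i
    by_cases hi : i = a
    · simpa [hi] using hm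
    · simp only [hi, if_false]
      exact twiceDiffOn_add ⟨fun t => (f i t).2.1, fun t ht => (hf.jet i t ht).1,
        fun t ht => (hf.jet i t ht).2.differentiableWithinAt⟩ hm
  · intro t ht
    obtain ⟨σ, hσ⟩ := hf.perm t ht
    refine ⟨σ, fun i => ?_⟩
    have e : (f i t).1 + m t = lam (σ i) t := by rw [hσ, hL1]; ring
    by_cases hi : i = a
    · subst hi
      rw [← e, hf.zero t ht]; simp
    · simpa [hi] using e

end ExtPar

open ExtPar

/-- Completion lemma (twice differentiable case): a partial twice differentiable
parameterization `μ₁,…,μ_k` of the values of twice differentiable functions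
`λ₁,…,λ_N` can be completed to a full one. -/
theorem extend_twice_differentiable_parameterization
    (I : Set ℝ) (hI : I.OrdConnected)
    (N k : ℕ) (hk : k ≤ N)
    (lam : Fin N → ℝ → ℝ) (hlam : ∀ i, TwiceDiffOn (lam i) I)
    (μ : Fin k → ℝ → ℝ) (hμ : ∀ j, TwiceDiffOn (μ j) I)
    (hle : ∀ t ∈ I, ∀ z : ℝ,
      {j : Fin k | μ j t = z}.ncard ≤ {i : Fin N | lam i t = z}.ncard) :
    ∃ ν : Fin N → ℝ → ℝ,
      (∀ j, TwiceDiffOn (ν j) I) ∧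
      (∀ j : Fin N, (h : (j : ℕ) < k) → ν j = μ ⟨j, h⟩) ∧
      (∀ t ∈ I, ∀ z : ℝ,
        {j : Fin N | ν j t = z}.ncard = {i : Fin N | lam i t = z}.ncard) := by
  classical
  have hcount : ∀ (ν : Fin N → ℝ → ℝ) (t : ℝ),
      (∃ σ : Equiv.Perm (Fin N), ∀ i, ν i t = lam (σ i) t) → ∀ z : ℝ,
        {j : Fin N | ν j t = z}.ncard = {i : Fin N | lam i t = z}.ncard := by
    rintro ν t ⟨σ, hσ⟩ z
    have : {j : Fin N | ν j t = z} = σ ⁻¹' {i : Fin N | lam i t = z} := by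
      ext j; simp [hσ]
    rw [this, ← Equiv.image_symm_eq_preimage, Set.ncard_image_of_injective _ σ.symm.injective]
  have main : ∀ q, q ≤ k → ∃ ν : Fin N → ℝ → ℝ, (∀ j, TwiceDiffOn (ν j) I) ∧
      (∀ j : Fin N, (h : (j : ℕ) < k) → (j : ℕ) < q → ν j = μ ⟨j, h⟩) ∧
      ∀ t ∈ I, ∃ σ : Equiv.Perm (Fin N), ∀ i, ν i t = lam (σ i) t := by
    intro q
    induction q with
    | zero => exact fun _ => ⟨lam, hlam, fun j _ h => absurd h (Nat.not_lt_zero _),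
        fun t _ => ⟨1, fun i => rfl⟩⟩
    | succ q ih =>
      intro hq
      obtain ⟨ν, hν, hνμ, hperm⟩ := ih (by omega)
      have hqk : q < k := hq
      let A := {j : Fin N // q ≤ (j : ℕ)}
      let a : A := ⟨⟨q, by omega⟩, le_rfl⟩
      obtain ⟨ρ, hρa, hρ, hρp⟩ := extend_one hI (fun i : A => ν i.1) (fun i => hν i.1)
        (μ ⟨q, hqk⟩) (hμ _) (by
          intro t ht
          by_contra hcon
          push Not at hcon
          have hc := hcount ν t (hperm t ht) (μ ⟨q, hqk⟩ t)
          have hl := hle t ht (μ ⟨q, hqk⟩ t)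
          rw [← hc] at hl
          have hlt : (Fin.castLE hk ⁻¹' {j : Fin N | ν j t = μ ⟨q, hqk⟩ t}).ncard <
              {j : Fin k | μ j t = μ ⟨q, hqk⟩ t}.ncard := by
            refine Set.ncard_lt_ncard ⟨?_, ?_⟩ (Set.toFinite _)
            · intro j hj
              have hj' : ν (Fin.castLE hk j) t = μ ⟨q, hqk⟩ t := hj
              have hjq : (j : ℕ) < q := by
                by_contra hge
                exact hcon ⟨Fin.castLE hk j, by simpa using hge⟩ hj'
              rw [hνμ (Fin.castLE hk j) j.2 hjq] at hj'
              exact hj'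
            · intro hsub
              have := hsub (show (⟨q, hqk⟩ : Fin k) ∈ _ from rfl)
              exact hcon a this
          have heq : (Fin.castLE hk ⁻¹' {j : Fin N | ν j t = μ ⟨q, hqk⟩ t}).ncard =
              {j : Fin N | ν j t = μ ⟨q, hqk⟩ t}.ncard := by
            apply Set.ncard_preimage_of_injective_subset_range (Fin.castLE_injective hk)
            intro j hj
            have hjq : (j : ℕ) < q := by
              by_contra hge
              exact hcon ⟨j, by simpa using hge⟩ hj
            exact ⟨⟨j, by omega⟩, rfl⟩
          omega) a
      refine ⟨fun j => if hj : q ≤ (j : ℕ) then ρ ⟨j, hj⟩ else ν j, ?_, ?_, ?_⟩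
      · intro j
        by_cases hj : q ≤ (j : ℕ)
        · simp only [hj, dif_pos]; exact hρ _
        · simp only [hj, dif_neg, not_false_iff]; exact hν _
      · intro j hjk hjq
        by_cases hj : q ≤ (j : ℕ)
        · have hjq' : (j : ℕ) = q := by omega
          obtain ⟨j, hjN⟩ := j
          obtain rfl : j = q := hjq'
          simp only [le_refl, dif_pos]; exact hρa
        · simp only [hj, dif_neg, not_false_iff]
          exact hνμ j hjk (by omega)
      · intro t ht
        obtain ⟨σ, hσ⟩ := hperm t ht
        obtain ⟨τ, hτ⟩ := hρp t ht
        refine ⟨(Equiv.Perm.ofSubtype τ).trans σ, fun j => ?_⟩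
        rw [Equiv.trans_apply, ← hσ]
        by_cases hj : q ≤ (j : ℕ)
        · rw [Equiv.Perm.ofSubtype_apply_of_mem τ hj]
          simp only [hj, dif_pos]; exact hτ _
        · rw [Equiv.Perm.ofSubtype_apply_of_not_mem τ hj]
          simp only [hj, dif_neg, not_false_iff]
  obtain ⟨ν, h1, h2, h3⟩ := main k le_rfl
  exact ⟨ν, h1, fun j h => h2 j h h, fun t ht => hcount ν t (h3 t ht)⟩
end
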